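/- In the unweighted setting, under binary XOS valuations, MNW is not strategyproof regardless of tie-breaking: there exist a finite set of goods G, a profile (v_1,…,v_n) of binary XOS valuations on G, an agent i, and a binary XOS valuation v'_i on G, such that for every MNW allocation A of the instance with profile (v_1,…,v_n) and every MNW allocation A' of the instance with profile obtained by replacing v_i with v'_i, we have v_i(A'_i) > v_i(A_i) (utilities measured by agent i's true valuation v_i). -/

import Mathlib

open Finset

/-- An allocation of (some of) the goods in `M` to `n` agents: pairwise disjoint bundles. -/
def IsAlloc (n : ℕ) (M : Finset ℕ) (A : Fin n → Finset ℕ) : Prop :=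
  (∀ i, A i ⊆ M) ∧ ∀ i j : Fin n, i ≠ j → Disjoint (A i) (A j)

/-- A (real-valued) valuation on the goods in `M`: normalized and nonnegative. -/
def ValuationOn (M : Finset ℕ) (v : Finset ℕ → ℝ) : Prop :=
  v ∅ = 0 ∧ ∀ S ⊆ M, 0 ≤ v S

/-- Binary valuation: every marginal gain is `0` or `1`. -/
def BinaryOn (M : Finset ℕ) (v : Finset ℕ → ℝ) : Prop :=
  ∀ S ⊆ M, ∀ g ∈ M, g ∉ S → v (insert g S) = v S ∨ v (insert g S) = v S + 1

/-- XOS valuation: the pointwise maximum of a finite nonempty family of additive valuations. -/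
def XOSOn (M : Finset ℕ) (v : Finset ℕ → ℝ) : Prop :=
  ∃ (k : ℕ) (h : Fin (k + 1) → ℕ → ℝ),
    (∀ j g, 0 ≤ h j g) ∧
    ∀ S ⊆ M, v S = Finset.univ.sup' Finset.univ_nonempty fun j => ∑ g ∈ S, h j g

/-- Binary XOS valuation. -/
def BinaryXOSOn (M : Finset ℕ) (v : Finset ℕ → ℝ) : Prop :=
  ValuationOn M v ∧ BinaryOn M v ∧ XOSOn M v

/-- Subadditive valuation. -/
def SubadditiveOn (M : Finset ℕ) (v : Finset ℕ → ℝ) : Prop :=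
  ∀ S T : Finset ℕ, S ⊆ M → T ⊆ M → v (S ∪ T) ≤ v S + v T

/-- Binary subadditive valuation. -/
def BinarySubadditiveOn (M : Finset ℕ) (v : Finset ℕ → ℝ) : Prop :=
  ValuationOn M v ∧ BinaryOn M v ∧ SubadditiveOn M v

/-- Additive valuation with nonnegative values. -/
def AdditiveOn (M : Finset ℕ) (v : Finset ℕ → ℝ) : Prop :=
  (∀ g ∈ M, 0 ≤ v {g}) ∧ ∀ S ⊆ M, v S = ∑ g ∈ S, v {g}

/-- Restricted additive (generalized binary) profile: each agent's value for each good
is `0` or a common good-dependent value `h g`. -/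
def RestrictedAdditive (n : ℕ) (M : Finset ℕ) (v : Fin n → Finset ℕ → ℝ) : Prop :=
  (∀ i, AdditiveOn M (v i)) ∧
  ∃ h : ℕ → ℝ, (∀ g ∈ M, 0 ≤ h g) ∧ ∀ i, ∀ g ∈ M, v i {g} = 0 ∨ v i {g} = h g

/-- The Nash welfare (product of utilities) of an allocation. -/
def NashProd (n : ℕ) (v : Fin n → Finset ℕ → ℝ) (A : Fin n → Finset ℕ) : ℝ :=
  ∏ i, v i (A i)

/-- The set of agents receiving positive utility. -/
noncomputable def PosAgentsR (n : ℕ) (v : Fin n → Finset ℕ → ℝ) (A : Fin n → Finset ℕ) :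
    Finset (Fin n) :=
  Finset.univ.filter fun i => 0 < v i (A i)

/-- The product of the positive utilities. -/
noncomputable def PosProd (n : ℕ) (v : Fin n → Finset ℕ → ℝ) (A : Fin n → Finset ℕ) : ℝ :=
  ∏ i ∈ PosAgentsR n v A, v i (A i)

/-- `A` is a maximum Nash welfare (MNW) allocation: it maximizes the product of utilities;
if the maximum product is `0`, it first maximizes the number of positively-served agents and
then the product of the positive utilities. -/
def IsMNW (n : ℕ) (M : Finset ℕ) (v : Fin n → Finset ℕ → ℝ) (A : Fin n → Finset ℕ) : Prop :=
  IsAlloc n M A ∧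
  ((∃ B, IsAlloc n M B ∧ NashProd n v B ≠ 0) →
    ∀ B, IsAlloc n M B → NashProd n v B ≤ NashProd n v A) ∧
  ((∀ B, IsAlloc n M B → NashProd n v B = 0) →
    ∀ B, IsAlloc n M B →
      (PosAgentsR n v B).card ≤ (PosAgentsR n v A).card ∧
      ((PosAgentsR n v B).card = (PosAgentsR n v A).card →
        PosProd n v B ≤ PosProd n v A))

/-- Binary XOS valuation generated by two sets. -/
noncomputable def val2 (T Z S : Finset ℕ) : ℝ := ((max (S ∩ T).card (S ∩ Z).card : ℕ) : ℝ)

lemma card_insert_inter (g : ℕ) (S T : Finset ℕ) (h : g ∉ S) :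
    (insert g S ∩ T).card = (S ∩ T).card + if g ∈ T then 1 else 0 := by
  split_ifs with hT
  · rw [Finset.insert_inter_of_mem hT, Finset.card_insert_of_notMem (by simp [h])]
  · rw [Finset.insert_inter_of_notMem hT, add_zero]

lemma val2_xos (M T Z : Finset ℕ) : BinaryXOSOn M (val2 T Z) := by
  refine ⟨⟨by simp [val2], fun S _ => by unfold val2; positivity⟩, ?_, ?_⟩
  · intro S _ g _ hg
    unfold val2
    rw [card_insert_inter g S T hg, card_insert_inter g S Z hg]
    norm_cast
    split_ifs <;> omega
  · refine ⟨1, fun j g => if g ∈ (if j = 0 then T else Z) then 1 else 0, ?_, ?_⟩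
    · intro j g
      dsimp only
      split_ifs <;> norm_num
    · intro S _
      have key : ∀ j : Fin 2, (∑ g ∈ S, if g ∈ (if j = 0 then T else Z) then (1 : ℝ) else 0)
          = ((S ∩ (if j = 0 then T else Z)).card : ℝ) := by
        intro j
        rw [Finset.sum_ite_mem]
        simp
      unfold val2
      apply le_antisymm
      · rw [Nat.cast_max]
        apply max_le
        · refine le_trans (le_of_eq ?_) (Finset.le_sup' _ (Finset.mem_univ (0 : Fin 2)))
          rw [key]; simp
        · refine le_trans (le_of_eq ?_) (Finset.le_sup' _ (Finset.mem_univ (1 : Fin 2)))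
          rw [key]; simp
      · apply Finset.sup'_le
        intro j _
        rw [key]
        norm_cast
        split_ifs <;> simp

/-- Any MNW allocation beats any given allocation with nonzero product. -/
lemma mnw_ge {n : ℕ} {M : Finset ℕ} {v : Fin n → Finset ℕ → ℝ} {A B : Fin n → Finset ℕ}
    (hA : IsMNW n M v A) (hB : IsAlloc n M B) (h0 : NashProd n v B ≠ 0) :
    NashProd n v B ≤ NashProd n v A := hA.2.1 ⟨B, hB, h0⟩ B hB

lemma split_card (A B : Finset ℕ) (h : Disjoint A B) :
    (A ∩ {0, 1, 2}).card + (B ∩ {0, 1, 2, 3, 4, 5}).card ≤ 6 := by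
  have h1 : (A ∩ {0, 1, 2}).card ≤ (A ∩ {0, 1, 2, 3, 4, 5}).card := by
    apply Finset.card_le_card
    apply Finset.inter_subset_inter_left
    decide
  have h2 : ((A ∩ {0, 1, 2, 3, 4, 5}) ∪ (B ∩ {0, 1, 2, 3, 4, 5})).card ≤ 6 := by
    rw [← Finset.union_inter_distrib_right]
    exact (Finset.card_le_card Finset.inter_subset_right).trans (by decide)
  rw [Finset.card_union_of_disjoint
    (h.mono Finset.inter_subset_left Finset.inter_subset_left)] at h2
  omega

theorem mnwNotStrategyproofXOS :
    ∃ (M : Finset ℕ) (n : ℕ) (v : Fin n → Finset ℕ → ℝ) (i : Fin n)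
      (vfalse : Finset ℕ → ℝ),
      (∀ j, BinaryXOSOn M (v j)) ∧ BinaryXOSOn M vfalse ∧
      ∀ A A' : Fin n → Finset ℕ,
        IsMNW n M v A → IsMNW n M (Function.update v i vfalse) A' →
        v i (A i) < v i (A' i) := by
  refine ⟨Finset.range 8, 2, ![val2 {0, 1, 2} {6, 7},
    val2 {0, 1, 2, 3, 4, 5} {0, 1, 2, 3, 4, 5}], 0, val2 {0, 1, 2} {0, 1, 2}, ?_,
    val2_xos _ _ _, ?_⟩
  · intro j
    fin_cases j
    · exact val2_xos _ _ _
    · exact val2_xos _ _ _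
  intro A A' hA hA'
  have hd := split_card _ _ (hA.1.2 0 1 (by decide))
  have hd' := split_card _ _ (hA'.1.2 0 1 (by decide))
  have p1 : (12 : ℕ) ≤ max (A 0 ∩ {0, 1, 2}).card (A 0 ∩ {6, 7}).card *
      (A 1 ∩ {0, 1, 2, 3, 4, 5}).card := by
    have e : NashProd 2 ![val2 {0, 1, 2} {6, 7}, val2 {0, 1, 2, 3, 4, 5} {0, 1, 2, 3, 4, 5}]
        ![{6, 7}, {0, 1, 2, 3, 4, 5}] = ((12 : ℕ) : ℝ) := by
      simp only [NashProd, Fin.prod_univ_two, val2, Matrix.cons_val_zero, Matrix.cons_val_one]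
      rw [← Nat.cast_mul]
      congr 1
    have h := mnw_ge hA (B := ![{6, 7}, {0, 1, 2, 3, 4, 5}])
      (by unfold IsAlloc; decide) (by rw [e]; norm_num)
    rw [e] at h
    simp only [NashProd, Fin.prod_univ_two, val2, Matrix.cons_val_zero, Matrix.cons_val_one,
      max_self] at h
    exact_mod_cast h
  have p2 : (9 : ℕ) ≤ (A' 0 ∩ {0, 1, 2}).card * (A' 1 ∩ {0, 1, 2, 3, 4, 5}).card := by
    have hu : Function.update ![val2 {0, 1, 2} {6, 7},
        val2 {0, 1, 2, 3, 4, 5} {0, 1, 2, 3, 4, 5}] 0 (val2 {0, 1, 2} {0, 1, 2}) =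
        ![val2 {0, 1, 2} {0, 1, 2}, val2 {0, 1, 2, 3, 4, 5} {0, 1, 2, 3, 4, 5}] := by
      ext j; fin_cases j <;> simp
    rw [hu] at hA'
    have e : NashProd 2 ![val2 {0, 1, 2} {0, 1, 2},
        val2 {0, 1, 2, 3, 4, 5} {0, 1, 2, 3, 4, 5}]
        ![{0, 1, 2}, {3, 4, 5}] = ((9 : ℕ) : ℝ) := by
      simp only [NashProd, Fin.prod_univ_two, val2, Matrix.cons_val_zero, Matrix.cons_val_one]
      rw [← Nat.cast_mul]
      congr 1
    have h := mnw_ge hA' (B := ![{0, 1, 2}, {3, 4, 5}])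
      (by unfold IsAlloc; decide) (by rw [e]; norm_num)
    rw [e] at h
    simp only [NashProd, Fin.prod_univ_two, val2, Matrix.cons_val_zero, Matrix.cons_val_one,
      max_self] at h
    exact_mod_cast h
  have b1 : (A 0 ∩ {0, 1, 2}).card ≤ 3 :=
    (Finset.card_le_card Finset.inter_subset_right).trans (by decide)
  have b2 : (A 0 ∩ {6, 7}).card ≤ 2 :=
    (Finset.card_le_card Finset.inter_subset_right).trans (by decide)
  have b3 : (A' 0 ∩ {0, 1, 2}).card ≤ 3 :=
    (Finset.card_le_card Finset.inter_subset_right).trans (by decide)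
  simp only [val2, Matrix.cons_val_zero]
  norm_cast
  generalize (A 0 ∩ {0, 1, 2}).card = a at *
  generalize (A 0 ∩ {6, 7}).card = b at *
  generalize (A 1 ∩ {0, 1, 2, 3, 4, 5}).card = c at *
  generalize (A' 0 ∩ {0, 1, 2}).card = a' at *
  generalize (A' 1 ∩ {0, 1, 2, 3, 4, 5}).card = c' at *
  have r1 : max a b ≤ 2 := by
    by_contra hc
    have ha : a = 3 := by omega
    have hm : max a b = 3 := by omega
    rw [hm] at p1
    omega
  have r2 : a' = 3 := by
    interval_cases a' <;> omega
  omega
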